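/- Assume λ = sup_k m_k < ∞. For every n ∈ ℕ_+ with ⟨n⟩ ≥ 1 and every x ∈ I_{⟨n⟩+1}(e_{⟨n⟩−1} + e_{⟨n⟩}), one has |n K_n(x)| ≥ M_{⟨n⟩}² / (2π λ). -/

import Mathlib

open MeasureTheory Finset

noncomputable section

namespace Vilenkin

instance (n : ℕ) : MeasurableSpace (ZMod n) := ⊤

abbrev G (m : ℕ → ℕ) : Type := ∀ k, ZMod (m k)

def M (m : ℕ → ℕ) : ℕ → ℕ
  | 0 => 1
  | k + 1 => m k * M m k

def digit (m : ℕ → ℕ) (n k : ℕ) : ℕ := (n / M m k) % m k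

def rad (m : ℕ → ℕ) (k : ℕ) (x : G m) : ℂ :=
  Complex.exp (2 * (Real.pi : ℂ) * Complex.I * ((x k).val : ℂ) / (m k : ℂ))

def psi (m : ℕ → ℕ) (n : ℕ) (x : G m) : ℂ :=
  ∏ k ∈ Finset.range (n + 1), rad m k x ^ digit m n k

def D (m : ℕ → ℕ) (n : ℕ) (x : G m) : ℂ := ∑ k ∈ Finset.range n, psi m k x

def K (m : ℕ → ℕ) (n : ℕ) (x : G m) : ℂ := (n : ℂ)⁻¹ * ∑ k ∈ Finset.range n, D m k x

def cyl (m : ℕ → ℕ) (n : ℕ) (x : G m) : Set (G m) := {y | ∀ j < n, y j = x j}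

def e (m : ℕ → ℕ) (k : ℕ) : G m := fun j => if j = k then 1 else 0

def lo (m : ℕ → ℕ) (n : ℕ) : ℕ := sInf {j | digit m n j ≠ 0}

def hi (m : ℕ → ℕ) (n : ℕ) : ℕ := sSup {j | digit m n j ≠ 0}

def Iij (m : ℕ → ℕ) (N i j : ℕ) : Set (G m) :=
  if j = N then {x | x i ≠ 0 ∧ ∀ t < N, t ≠ i → x t = 0}
  else {x | (∀ t < i, x t = 0) ∧ x i ≠ 0 ∧ (∀ t, i < t → t < j → x t = 0) ∧ x j ≠ 0}

def IsVilenkinMeasure (m : ℕ → ℕ) (μ : Measure (G m)) : Prop :=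
  IsProbabilityMeasure μ ∧ ∀ (n : ℕ) (x : G m), μ (cyl m n x) = (M m n : ENNReal)⁻¹

def fhat (m : ℕ → ℕ) (μ : Measure (G m)) (f : G m → ℂ) (k : ℕ) : ℂ :=
  ∫ x, f x * (starRingEnd ℂ) (psi m k x) ∂μ

def S (m : ℕ → ℕ) (μ : Measure (G m)) (f : G m → ℂ) (n : ℕ) (x : G m) : ℂ :=
  ∑ k ∈ Finset.range n, fhat m μ f k * psi m k x

def sigma (m : ℕ → ℕ) (μ : Measure (G m)) (f : G m → ℂ) (n : ℕ) (x : G m) : ℂ :=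
  (n : ℂ)⁻¹ * ∑ k ∈ Finset.range n, S m μ f k x

end Vilenkin

open Vilenkin

namespace Vilenkin

theorem sum_range_mul_add {A : Type*} [AddCommMonoid A] (f : ℕ → A) (a b : ℕ) :
    ∑ j ∈ range (a * b), f j = ∑ u ∈ range b, ∑ r ∈ range a, f (r + a * u) := by
  induction b with
  | zero => simp
  | succ b ih =>
    rw [Nat.mul_succ, Finset.sum_range_add, ih, Finset.sum_range_succ]
    simp [add_comm]

theorem sum_range_mul_eq_zero {R : Type*} [CommSemiring R] {f g h : ℕ → R} {a : ℕ}
    (hf : ∀ u, ∀ r < a, f (r + a * u) = g r * h u) (hg : ∑ r ∈ range a, g r = 0) (b : ℕ) :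
    ∑ j ∈ range (a * b), f j = 0 := by
  rw [sum_range_mul_add]
  refine Finset.sum_eq_zero fun u _ => ?_
  rw [Finset.sum_congr rfl fun r hr => hf u r (Finset.mem_range.1 hr), ← Finset.sum_mul, hg,
    zero_mul]

theorem sum_sum_range {R : Type*} [CommRing R] (f : ℕ → R) (n : ℕ) :
    ∑ k ∈ range n, ∑ j ∈ range k, f j = ∑ j ∈ range n, ((n : R) - 1 - j) * f j := by
  induction n with
  | zero => simp
  | succ n ih =>
    rw [Finset.sum_range_succ, ih, Finset.sum_range_succ, ← Finset.sum_add_distrib]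
    have : ((n + 1 : ℕ) : R) - 1 - n = 0 := by push_cast; ring
    rw [this, zero_mul, add_zero]
    refine Finset.sum_congr rfl fun j _ => ?_
    push_cast
    ring

theorem sub_one_mul_sum_natCast_mul_pow {R : Type*} [CommRing R] (w : R) (k : ℕ) :
    (w - 1) * ∑ s ∈ range k, (s : R) * w ^ s = k * w ^ k - w * ∑ s ∈ range k, w ^ s := by
  induction k with
  | zero => simp
  | succ k ih =>
    rw [Finset.sum_range_succ, mul_add, ih, Finset.sum_range_succ]
    push_cast
    ring

theorem M_pos {m : ℕ → ℕ} (hm : ∀ k, 2 ≤ m k) (k : ℕ) : 0 < M m k := by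
  induction k with
  | zero => exact Nat.one_pos
  | succ k ih => exact Nat.mul_pos (by have := hm k; omega) ih

theorem lt_M {m : ℕ → ℕ} (hm : ∀ k, 2 ≤ m k) (k : ℕ) : k < M m k := by
  induction k with
  | zero => exact Nat.one_pos
  | succ k ih =>
    have := Nat.mul_le_mul_right (M m k) (hm k)
    change k + 1 < m k * M m k
    omega

theorem M_dvd {m : ℕ → ℕ} {k l : ℕ} (h : k ≤ l) : M m k ∣ M m l := by
  induction l, h using Nat.le_induction with
  | base => exact dvd_rfl
  | succ l _ ih => exact ih.mul_left _

theorem M_mono {m : ℕ → ℕ} (hm : ∀ k, 2 ≤ m k) {k l : ℕ} (h : k ≤ l) : M m k ≤ M m l :=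
  Nat.le_of_dvd (M_pos hm l) (M_dvd h)

theorem digit_of_lt {m : ℕ → ℕ} (hm : ∀ k, 2 ≤ m k) {r k l : ℕ} (hr : r < M m l) (h : l ≤ k) :
    digit m r k = 0 := by
  rw [digit, Nat.div_eq_of_lt (hr.trans_le (M_mono hm h)), Nat.zero_mod]

theorem digit_add_mul_of_lt {m : ℕ → ℕ} (hm : ∀ k, 2 ≤ m k) {k l : ℕ} (h : k < l) (r u : ℕ) :
    digit m (r + M m l * u) k = digit m r k := by
  obtain ⟨c, hc⟩ := M_dvd (m := m) (Nat.succ_le_of_lt h)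
  have hc' : M m l = m k * M m k * c := hc
  have : r + M m l * u = r + M m k * (m k * (c * u)) := by rw [hc']; ring
  rw [digit, this, Nat.add_mul_div_left _ _ (M_pos hm k), Nat.add_mul_mod_self_left, digit]

theorem digit_add_mul_of_le {m : ℕ → ℕ} (hm : ∀ k, 2 ≤ m k) {k l r : ℕ} (h : l ≤ k)
    (hr : r < M m l) (u : ℕ) : digit m (r + M m l * u) k = digit m (M m l * u) k := by
  obtain ⟨d, hd⟩ := M_dvd (m := m) h
  rw [digit, digit, hd, ← Nat.div_div_eq_div_mul, ← Nat.div_div_eq_div_mul,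
    Nat.add_mul_div_left _ _ (M_pos hm l), Nat.div_eq_of_lt hr,
    Nat.mul_div_cancel_left _ (M_pos hm l), zero_add]

theorem digit_add_mul {m : ℕ → ℕ} (hm : ∀ k, 2 ≤ m k) {l r : ℕ} (hr : r < M m l) (u k : ℕ) :
    digit m (r + M m l * u) k = digit m r k + digit m (M m l * u) k := by
  rcases lt_or_ge k l with h | h
  · have h0 := digit_add_mul_of_lt hm h 0 u
    rw [zero_add] at h0
    rw [digit_add_mul_of_lt hm h, h0]
    simp [digit]
  · rw [digit_add_mul_of_le hm h hr, digit_of_lt hm hr h, zero_add]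

theorem digit_M_mul {m : ℕ → ℕ} (hm : ∀ k, 2 ≤ m k) {l v : ℕ} (hv : v < m l) (k : ℕ) :
    digit m (M m l * v) k = if k = l then v else 0 := by
  split_ifs with h
  · subst h
    rw [digit, Nat.mul_div_cancel_left _ (M_pos hm k), Nat.mod_eq_of_lt hv]
  · rcases lt_or_gt_of_ne h with h | h
    · have h0 := digit_add_mul_of_lt hm h 0 v
      rw [zero_add] at h0
      rw [h0]
      simp [digit]
    · refine digit_of_lt hm (l := l + 1) ?_ h
      change _ < m l * M m l
      rw [mul_comm]
      exact Nat.mul_lt_mul_of_pos_right hv (M_pos hm l)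

theorem psi_eq_prod {m : ℕ → ℕ} (hm : ∀ k, 2 ≤ m k) {n l : ℕ} (h : n < M m l) (x : G m) :
    psi m n x = ∏ k ∈ range l, rad m k x ^ digit m n k := by
  have key : ∀ {a b : ℕ}, a ≤ b → n < M m a →
      ∏ k ∈ range a, rad m k x ^ digit m n k = ∏ k ∈ range b, rad m k x ^ digit m n k := by
    intro a b hab ha
    refine Finset.prod_subset (Finset.range_mono hab) fun k _ hk => ?_
    rw [digit_of_lt hm ha (by simpa using hk), pow_zero]
  have h1 : n < M m (n + 1) := (Nat.lt_succ_self n).trans (lt_M hm _)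
  rcases le_total l (n + 1) with hl | hl
  · exact (key hl h).symm
  · exact key hl h1

theorem psi_add_mul {m : ℕ → ℕ} (hm : ∀ k, 2 ≤ m k) {l r : ℕ} (hr : r < M m l) (u : ℕ) (x : G m) :
    psi m (r + M m l * u) x = psi m r x * psi m (M m l * u) x := by
  have h := lt_M hm (r + M m l * u)
  rw [psi_eq_prod hm h, psi_eq_prod hm ((Nat.le_add_right r _).trans_lt h),
    psi_eq_prod hm ((Nat.le_add_left (M m l * u) r).trans_lt h), ← Finset.prod_mul_distrib]
  exact Finset.prod_congr rfl fun k _ => by rw [digit_add_mul hm hr, pow_add]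

theorem psi_M_mul {m : ℕ → ℕ} (hm : ∀ k, 2 ≤ m k) {l v : ℕ} (hv : v < m l) (x : G m) :
    psi m (M m l * v) x = rad m l x ^ v := by
  have h : M m l * v < M m (l + 1) := by
    change _ < m l * M m l
    rw [mul_comm]
    exact Nat.mul_lt_mul_of_pos_right hv (M_pos hm l)
  rw [psi_eq_prod hm h, Finset.prod_eq_single l]
  · rw [digit_M_mul hm hv, if_pos rfl]
  · intro k _ hk
    rw [digit_M_mul hm hv, if_neg hk, pow_zero]
  · simp

theorem psi_eq_one {m : ℕ → ℕ} (hm : ∀ k, 2 ≤ m k) {l r : ℕ} (hr : r < M m l) {x : G m}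
    (hx : ∀ k < l, x k = 0) : psi m r x = 1 := by
  rw [psi_eq_prod hm hr]
  refine Finset.prod_eq_one fun k hk => ?_
  have : NeZero (m k) := ⟨by have := hm k; omega⟩
  simp [rad, hx k (Finset.mem_range.1 hk)]

theorem rad_eq (m : ℕ → ℕ) (k : ℕ) (x : G m) :
    rad m k x = Complex.exp (Complex.I * ((2 * Real.pi * (x k).val / m k : ℝ) : ℂ)) := by
  rw [rad]
  push_cast
  ring_nf

theorem rad_of_eq_one {m : ℕ → ℕ} (hm : ∀ k, 2 ≤ m k) {k : ℕ} {x : G m} (hx : x k = 1) :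
    rad m k x = Complex.exp (2 * Real.pi * Complex.I / m k) := by
  have : Fact (1 < m k) := ⟨by have := hm k; omega⟩
  simp [rad, hx, ZMod.val_one]

theorem norm_rad (m : ℕ → ℕ) (k : ℕ) (x : G m) : ‖rad m k x‖ = 1 := by
  rw [rad_eq, mul_comm, Complex.norm_exp_ofReal_mul_I]

theorem norm_psi (m : ℕ → ℕ) (n : ℕ) (x : G m) : ‖psi m n x‖ = 1 := by
  simp [psi, norm_prod, norm_rad]

theorem exp_pow_eq (a v : ℕ) : Complex.exp (2 * Real.pi * Complex.I / a) ^ v =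
    Complex.exp (Complex.I * ((2 * Real.pi * v / a : ℝ) : ℂ)) := by
  rw [← Complex.exp_nat_mul]
  push_cast
  ring_nf

theorem sin_pi_div_le_sin {a v : ℕ} (hv : 0 < v) (hva : v < a) :
    Real.sin (Real.pi / a) ≤ Real.sin (Real.pi * v / a) := by
  have ha : (0 : ℝ) < a := by exact_mod_cast hv.trans hva
  have hpi := Real.pi_pos
  have key : ∀ w : ℕ, 0 < w → 2 * w ≤ a →
      Real.sin (Real.pi / a) ≤ Real.sin (Real.pi * w / a) := by
    intro w hw hwa
    have h1 : (1 : ℝ) ≤ w := by exact_mod_cast hw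
    have h2 : (2 : ℝ) * w ≤ a := by exact_mod_cast hwa
    refine Real.sin_le_sin_of_le_of_le_pi_div_two ?_ ?_ ?_
    · have : 0 < Real.pi / a := by positivity
      linarith
    · rw [div_le_div_iff₀ ha two_pos]
      nlinarith
    · gcongr
      nlinarith
  rcases le_total (2 * v) a with h | h
  · exact key v hv h
  · have := key (a - v) (by omega) (by omega)
    rwa [Nat.cast_sub hva.le, show Real.pi * ((a : ℝ) - v) / a = Real.pi - Real.pi * v / a by
      field_simp, Real.sin_pi_sub] at this

theorem norm_exp_sub_one_le_norm_pow_sub_one {a v : ℕ} (hv : 0 < v) (hva : v < a) :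
    ‖Complex.exp (2 * Real.pi * Complex.I / a) - 1‖ ≤
      ‖Complex.exp (2 * Real.pi * Complex.I / a) ^ v - 1‖ := by
  have ha : (1 : ℝ) ≤ a := by exact_mod_cast (by omega : 1 ≤ a)
  have h1 := exp_pow_eq a 1
  rw [pow_one] at h1
  rw [exp_pow_eq, h1, Complex.norm_exp_I_mul_ofReal_sub_one,
    Complex.norm_exp_I_mul_ofReal_sub_one, Real.norm_eq_abs, Real.norm_eq_abs, abs_mul, abs_mul,
    show 2 * Real.pi * ((1 : ℕ) : ℝ) / a / 2 = Real.pi / a by push_cast; ring,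
    show 2 * Real.pi * (v : ℝ) / a / 2 = Real.pi * v / a by ring]
  have h0 : 0 ≤ Real.sin (Real.pi / a) :=
    Real.sin_nonneg_of_nonneg_of_le_pi (by positivity) (div_le_self Real.pi_pos.le ha)
  rw [abs_of_nonneg h0]
  gcongr
  exact (sin_pi_div_le_sin hv hva).trans (le_abs_self _)

theorem norm_exp_sub_one_le (a : ℕ) :
    ‖Complex.exp (2 * Real.pi * Complex.I / a) - 1‖ ≤ 2 * Real.pi / a := by
  have h1 := exp_pow_eq a 1
  rw [pow_one] at h1
  rw [h1]
  refine (Real.norm_exp_I_mul_ofReal_sub_one_le).trans ?_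
  have := Real.pi_pos
  rw [Real.norm_of_nonneg (by positivity)]
  simp

theorem exp_ne_one {a : ℕ} (ha : 2 ≤ a) : Complex.exp (2 * Real.pi * Complex.I / a) ≠ 1 :=
  (Complex.isPrimitiveRoot_exp a (by omega)).ne_one (by omega)

theorem one_le_norm_geom_sum {a v : ℕ} (hv : 0 < v) (hva : v < a) :
    1 ≤ ‖∑ s ∈ range v, Complex.exp (2 * Real.pi * Complex.I / a) ^ s‖ := by
  have h := exp_ne_one (a := a) (by omega)
  rw [geom_sum_eq h, norm_div, one_le_div (norm_pos_iff.2 (sub_ne_zero.2 h))]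
  exact norm_exp_sub_one_le_norm_pow_sub_one hv hva

theorem geom_sum_exp_eq_zero {a : ℕ} (ha : 2 ≤ a) :
    ∑ s ∈ range a, Complex.exp (2 * Real.pi * Complex.I / a) ^ s = 0 :=
  (Complex.isPrimitiveRoot_exp a (by omega)).geom_sum_eq_zero (by omega)

theorem le_norm_sum_natCast_mul_exp_pow {a : ℕ} (ha : 2 ≤ a) :
    (a : ℝ) ^ 2 / (2 * Real.pi) ≤
      ‖∑ s ∈ range a, (s : ℂ) * Complex.exp (2 * Real.pi * Complex.I / a) ^ s‖ := by
  have h := sub_one_mul_sum_natCast_mul_pow (Complex.exp (2 * Real.pi * Complex.I / a)) a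
  rw [geom_sum_exp_eq_zero ha, (Complex.isPrimitiveRoot_exp a (by omega)).pow_eq_one, mul_zero,
    sub_zero, mul_one] at h
  have h' := congrArg norm h
  rw [norm_mul, Complex.norm_natCast] at h'
  have hle := mul_le_mul_of_nonneg_right (norm_exp_sub_one_le a)
    (norm_nonneg (∑ s ∈ range a, (s : ℂ) * Complex.exp (2 * Real.pi * Complex.I / a) ^ s))
  rw [h'] at hle
  have ha' : (0 : ℝ) < a := by exact_mod_cast (by omega : 0 < a)
  have hpi := Real.pi_pos
  rw [div_mul_eq_mul_div, le_div_iff₀ ha'] at hle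
  rw [div_le_iff₀ (by positivity)]
  nlinarith

theorem digit_lo_ne_zero {m : ℕ → ℕ} {n : ℕ} (h : 1 ≤ lo m n) : digit m n (lo m n) ≠ 0 := by
  refine Nat.sInf_mem (s := {j | digit m n j ≠ 0}) ?_
  exact Nat.nonempty_of_pos_sInf h

theorem M_dvd_of_le_lo {m : ℕ → ℕ} {n j : ℕ} (h : j ≤ lo m n) :
    M m j ∣ n := by
  induction j with
  | zero => exact one_dvd _
  | succ j ih =>
    have h0 : digit m n j = 0 := by
      by_contra hj
      exact absurd (Nat.sInf_le (s := {j | digit m n j ≠ 0}) hj) (not_le.2 h)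
    change m j * M m j ∣ n
    rw [mul_comm]
    exact (Nat.dvd_div_iff_mul_dvd (ih (by omega))).1 (Nat.dvd_of_mod_eq_zero h0)

theorem psi_add_M_mul {m : ℕ → ℕ} (hm : ∀ k, 2 ≤ m k) {L : ℕ} {x : G m} (h0 : ∀ k < L, x k = 0)
    (h1 : x L = 1) {t s : ℕ} (ht : t < M m L) (hs : s < m L) :
    psi m (t + M m L * s) x = Complex.exp (2 * Real.pi * Complex.I / m L) ^ s := by
  rw [psi_add_mul hm ht, psi_eq_one hm ht h0, psi_M_mul hm hs, rad_of_eq_one hm h1, one_mul]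

theorem sum_psi_eq_zero {m : ℕ → ℕ} (hm : ∀ k, 2 ≤ m k) {L : ℕ} {x : G m} (h0 : ∀ k < L, x k = 0)
    (h1 : x L = 1) : ∑ r ∈ range (M m (L + 1)), psi m r x = 0 := by
  rw [show M m (L + 1) = M m L * m L from mul_comm _ _, sum_range_mul_add,
    Finset.sum_congr rfl fun s hs => Finset.sum_congr rfl fun t ht =>
      psi_add_M_mul hm h0 h1 (Finset.mem_range.1 ht) (Finset.mem_range.1 hs)]
  simp [← Finset.mul_sum, geom_sum_exp_eq_zero (hm L)]

theorem sum_natCast_mul_psi {m : ℕ → ℕ} (hm : ∀ k, 2 ≤ m k) {L : ℕ} {x : G m}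
    (h0 : ∀ k < L, x k = 0) (h1 : x L = 1) :
    ∑ r ∈ range (M m (L + 1)), (r : ℂ) * psi m r x =
      (M m L : ℂ) ^ 2 *
        ∑ s ∈ range (m L), (s : ℂ) * Complex.exp (2 * Real.pi * Complex.I / m L) ^ s := by
  set w := Complex.exp (2 * Real.pi * Complex.I / m L) with hw
  have hin : ∀ s ∈ range (m L), ∑ t ∈ range (M m L),
      ((t + M m L * s : ℕ) : ℂ) * psi m (t + M m L * s) x =
        (∑ t ∈ range (M m L), (t : ℂ)) * w ^ s + (M m L : ℂ) ^ 2 * (s * w ^ s) := by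
    intro s hs
    rw [Finset.sum_congr rfl fun t ht => by
      rw [psi_add_M_mul hm h0 h1 (Finset.mem_range.1 ht) (Finset.mem_range.1 hs)],
      ← Finset.sum_mul]
    push_cast
    rw [Finset.sum_add_distrib, Finset.sum_const, Finset.card_range, nsmul_eq_mul]
    ring
  rw [show M m (L + 1) = M m L * m L from mul_comm _ _, sum_range_mul_add,
    Finset.sum_congr rfl hin, Finset.sum_add_distrib, ← Finset.mul_sum, ← Finset.mul_sum,
    geom_sum_exp_eq_zero (hm L), mul_zero, zero_add]

theorem one_le_norm_sum_psi_M_mul {m : ℕ → ℕ} (hm : ∀ k, 2 ≤ m k) {N q : ℕ} {x : G m}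
    (h1 : x N = 1) (hq : q % m N ≠ 0) : 1 ≤ ‖∑ u ∈ range q, psi m (M m N * u) x‖ := by
  have hpos : 0 < m N := by have := hm N; omega
  set w := Complex.exp (2 * Real.pi * Complex.I / m N) with hw
  have hf : ∀ u, ∀ v < m N,
      psi m (M m N * (v + m N * u)) x = w ^ v * psi m (M m (N + 1) * u) x := by
    intro u v hv
    have hlt : M m N * v < M m (N + 1) := by
      change _ < m N * M m N
      rw [mul_comm]
      exact Nat.mul_lt_mul_of_pos_right hv (M_pos hm N)
    rw [show M m N * (v + m N * u) = M m N * v + M m (N + 1) * u by rw [M]; ring,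
      psi_add_mul hm hlt, psi_M_mul hm hv, rad_of_eq_one hm h1]
  have hsum : ∑ u ∈ range q, psi m (M m N * u) x =
      (∑ v ∈ range (q % m N), w ^ v) * psi m (M m (N + 1) * (q / m N)) x := by
    conv_lhs => rw [← Nat.div_add_mod q (m N)]
    rw [Finset.sum_range_add, sum_range_mul_eq_zero hf (geom_sum_exp_eq_zero (hm N)), zero_add,
      Finset.sum_mul]
    refine Finset.sum_congr rfl fun v hv => ?_
    rw [add_comm, hf _ _ ((Finset.mem_range.1 hv).trans (Nat.mod_lt _ hpos))]
  rw [hsum, norm_mul, norm_psi, mul_one]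
  exact one_le_norm_geom_sum (Nat.pos_of_ne_zero hq) (Nat.mod_lt _ hpos)

theorem natCast_mul_K {m : ℕ → ℕ} (n : ℕ) (x : G m) :
    (n : ℂ) * K m n x = ∑ j ∈ range n, ((n : ℂ) - 1 - j) * psi m j x := by
  rcases eq_or_ne n 0 with rfl | hn
  · simp
  · rw [K, mul_inv_cancel_left₀ (Nat.cast_ne_zero.2 hn), ← sum_sum_range]
    rfl

theorem M_mul_natCast_mul_K {m : ℕ → ℕ} (hm : ∀ k, 2 ≤ m k) {N : ℕ} {x : G m}
    (h : ∑ r ∈ range (M m N), psi m r x = 0) (q : ℕ) :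
    ((M m N * q : ℕ) : ℂ) * K m (M m N * q) x =
      -((∑ r ∈ range (M m N), (r : ℂ) * psi m r x) * ∑ u ∈ range q, psi m (M m N * u) x) := by
  rw [natCast_mul_K, sum_range_mul_add, Finset.mul_sum, ← Finset.sum_neg_distrib]
  refine Finset.sum_congr rfl fun u _ => ?_
  have hr : ∀ r ∈ range (M m N), (((M m N * q : ℕ) : ℂ) - 1 - ((r + M m N * u : ℕ) : ℂ)) *
      psi m (r + M m N * u) x = ((((M m N * q : ℕ) : ℂ) - 1 - M m N * u) * psi m r x -
        r * psi m r x) * psi m (M m N * u) x := by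
    intro r hr
    rw [psi_add_mul hm (Finset.mem_range.1 hr)]
    push_cast
    ring
  rw [Finset.sum_congr rfl hr, ← Finset.sum_mul, Finset.sum_sub_distrib, ← Finset.mul_sum, h]
  ring

end Vilenkin

theorem statement11 (m : ℕ → ℕ) (hm : ∀ k, 2 ≤ m k) (lam : ℕ) (hlam : ∀ k, m k ≤ lam)
    (n : ℕ) (hn : 1 ≤ n) (hlo : 1 ≤ lo m n)
    (x : G m) (hx : x ∈ cyl m (lo m n + 1) (e m (lo m n - 1) + e m (lo m n))) :
    (M m (lo m n) : ℝ) ^ 2 / (2 * Real.pi * lam) ≤ ‖(n : ℂ) * K m n x‖ := by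
  obtain ⟨L, hL⟩ : ∃ L, lo m n = L + 1 := ⟨lo m n - 1, by omega⟩
  have hd := digit_lo_ne_zero hlo
  have hdvd : M m (lo m n) ∣ n := M_dvd_of_le_lo le_rfl
  rw [hL] at hx hd hdvd ⊢
  obtain ⟨q, rfl⟩ := hdvd
  rw [digit, Nat.mul_div_cancel_left _ (M_pos hm _)] at hd
  have hx0 : ∀ k < L, x k = 0 := fun k hk => by
    rw [hx k (by omega)]
    simp [e, show k ≠ L by omega, show k ≠ L + 1 by omega]
  have hx1 : x L = 1 := by
    rw [hx L (by omega)]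
    simp [e]
  have hx2 : x (L + 1) = 1 := by
    rw [hx (L + 1) (by omega)]
    simp [e]
  have hlam1 : (1 : ℝ) ≤ lam := by
    exact_mod_cast (by decide : 1 ≤ 2).trans ((hm 0).trans (hlam 0))
  have hpi := Real.pi_pos
  rw [M_mul_natCast_mul_K hm (sum_psi_eq_zero hm hx0 hx1), norm_neg, norm_mul,
    sum_natCast_mul_psi hm hx0 hx1, norm_mul, norm_pow, Complex.norm_natCast]
  calc (M m (L + 1) : ℝ) ^ 2 / (2 * Real.pi * lam)
      ≤ (M m (L + 1) : ℝ) ^ 2 / (2 * Real.pi) := by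
        exact div_le_div_of_nonneg_left (by positivity) (by positivity)
          (le_mul_of_one_le_right (by positivity) hlam1)
    _ = (M m L : ℝ) ^ 2 * ((m L : ℝ) ^ 2 / (2 * Real.pi)) * 1 := by
        rw [M]
        push_cast
        ring
    _ ≤ _ := by
        gcongr
        · exact le_norm_sum_natCast_mul_exp_pow (hm L)
        · exact one_le_norm_sum_psi_M_mul hm hx2 hd
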